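/- arXiv:1709.00335 — 2 statements merged into one kernel-verified Lean document; each statement's English description precedes it below -/
import Mathlib

section
/- Let a, b, c be complex numbers with Re(b) > 1, such that neither c nor 2b − c is a negative integer, and such that none of (1+c)/2, (2+c)/2, b + (1−c)/2, b + (2−c)/2 is a nonpositive integer. Then Σ_{k=0}^{∞} k · (a)_k (1−a)_k (1+b)_k / (k! (1+c)_k (1+2b−c)_k) = ((a² − a + bc − c²)/(b(1−b))) · Γ((1+c)/2)Γ((2+c)/2)Γ(b+(1−c)/2)Γ(b+(2−c)/2) / (Γ((1+a+c)/2)Γ((2−a+c)/2)Γ(b+(a−c)/2)Γ(b+(1−a−c)/2)) + ((a² − a − 2b² + 3bc − c²)/(b(1−b))) · Γ((1+c)/2)Γ((2+c)/2)Γ(b+(1−c)/2)Γ(b+(2−c)/2) / (Γ((a+c)/2)Γ((1−a+c)/2)Γ(b+(1+a−c)/2)Γ(b+(2−a−c)/2)). -/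
open Finset Complex

/-- Shifted factorial (Pochhammer symbol) `(x)_k = x(x+1)⋯(x+k-1)`. -/
noncomputable def poch (x : ℂ) (k : ℕ) : ℂ := ∏ j ∈ Finset.range k, (x + j)

open Filter Topology

theorem poch_succ (x : ℂ) (k : ℕ) : poch x (k + 1) = poch x k * (x + k) := by
  simp [poch, Finset.prod_range_succ]

theorem poch_succ_left (x : ℂ) (k : ℕ) : poch x (k + 1) = x * poch (x + 1) k := by
  rw [poch, Finset.prod_range_succ', poch, mul_comm]
  congr 1
  · simp
  · exact Finset.prod_congr rfl fun j _ => by push_cast; ring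

theorem mul_poch_add_one (x : ℂ) (k : ℕ) : x * poch (x + 1) k = poch x k * (x + k) := by
  rw [← poch_succ_left, poch_succ]

theorem ne_neg_natCast_of_re_pos {x : ℂ} (hx : 0 < x.re) (m : ℕ) : x ≠ -m := by
  rintro rfl
  simp at hx
  linarith [(Nat.cast_nonneg m : (0 : ℝ) ≤ m)]

theorem Gamma_add_natCast {x : ℂ} (hx : ∀ m : ℕ, x ≠ -m) (k : ℕ) :
    Complex.Gamma (x + k) = Complex.Gamma x * poch x k := by
  induction k with
  | zero => simp [poch]
  | succ k ih =>
    have h : x + k ≠ 0 := fun h => hx k (eq_neg_of_add_eq_zero_left h)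
    rw [poch_succ, ← mul_assoc, ← ih, mul_comm, ← Complex.Gamma_add_one _ h]
    push_cast
    ring_nf

theorem inv_Gamma_eq (s : ℂ) : (Complex.Gamma s)⁻¹ = s * (Complex.Gamma (s + 1))⁻¹ := by
  simpa using Complex.one_div_Gamma_eq_self_mul_one_div_Gamma_add_one s

theorem tendsto_natCast_div_add (x : ℂ) :
    Tendsto (fun n : ℕ => (n : ℂ) / (x + n)) atTop (𝓝 1) := by
  simpa [add_comm] using tendsto_natCast_div_add_atTop x

/-- The comparison sequence `n ^ x * (n - 1)!` for `Γ (x + n)`. -/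
noncomputable def gammaModel (x : ℂ) (n : ℕ) : ℂ := (n : ℂ) ^ x * n.factorial / n

theorem gammaModel_ne_zero (x : ℂ) {n : ℕ} (hn : n ≠ 0) : gammaModel x n ≠ 0 := by
  have : (n : ℂ) ≠ 0 := Nat.cast_ne_zero.mpr hn
  simp [gammaModel, this, n.factorial_ne_zero]

theorem eventually_add_natCast_ne_zero (x : ℂ) : ∀ᶠ n : ℕ in atTop, x + n ≠ 0 := by
  obtain ⟨N, hN⟩ := exists_nat_gt ‖x‖
  filter_upwards [eventually_ge_atTop N] with n hn h
  have h1 : x = -n := eq_neg_of_add_eq_zero_left h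
  rw [h1, norm_neg, Complex.norm_natCast] at hN
  exact absurd hN (not_lt.mpr (by exact_mod_cast hn))

theorem tendsto_poch_div_gammaModel (x : ℂ) :
    Tendsto (fun n : ℕ => poch x n / gammaModel x n) atTop (𝓝 (Complex.Gamma x)⁻¹) := by
  have hinv : Tendsto (fun n : ℕ => (Complex.GammaSeq x n)⁻¹) atTop (𝓝 (Complex.Gamma x)⁻¹) := by
    by_cases hx : ∃ m : ℕ, x = -m
    · obtain ⟨m, rfl⟩ := hx
      rw [Complex.Gamma_neg_nat_eq_zero, inv_zero]
      refine tendsto_const_nhds.congr' ?_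
      filter_upwards [eventually_ge_atTop m] with n hn
      have : ∏ j ∈ Finset.range (n + 1), (-(m : ℂ) + j) = 0 :=
        Finset.prod_eq_zero (Finset.mem_range.mpr (Nat.lt_succ_of_le hn)) (by simp)
      simp [Complex.GammaSeq, this]
    · push Not at hx
      exact (Complex.GammaSeq_tendsto_Gamma x).inv₀ (Complex.Gamma_ne_zero hx)
  have h := hinv.mul (tendsto_natCast_div_add x)
  rw [mul_one] at h
  refine h.congr' ?_
  filter_upwards [eventually_add_natCast_ne_zero x, eventually_ne_atTop 0] with n hn hn0
  have h0 : (n : ℂ) ≠ 0 := Nat.cast_ne_zero.mpr hn0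
  have h1 : ((n.factorial : ℕ) : ℂ) ≠ 0 := Nat.cast_ne_zero.mpr n.factorial_ne_zero
  have h2 : (n : ℂ) ^ x ≠ 0 := by simp [h0]
  rw [Complex.GammaSeq, ← poch, poch_succ, gammaModel]
  field_simp

theorem tendsto_gammaModel_mul_inv_Gamma (x : ℂ) :
    Tendsto (fun n : ℕ => gammaModel x n * (Complex.Gamma (x + n))⁻¹) atTop (𝓝 1) := by
  obtain ⟨m, hm⟩ := exists_nat_gt (-x.re)
  induction m generalizing x with
  | zero =>
    have hre : 0 < x.re := by simpa using hm
    have hx := ne_neg_natCast_of_re_pos hre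
    have hΓ := Complex.Gamma_ne_zero hx
    have h := ((tendsto_poch_div_gammaModel x).const_mul (Complex.Gamma x)).inv₀
      (by simp [hΓ])
    rw [mul_inv_cancel₀ hΓ, inv_one] at h
    refine h.congr fun n => ?_
    rw [Gamma_add_natCast hx, mul_inv, inv_div, mul_inv]
    ring
  | succ m ih =>
    have h := (ih (x + 1) (by push_cast at hm; simp; linarith)).mul
      ((tendsto_natCast_div_add x).inv₀ one_ne_zero)
    rw [inv_one, mul_one] at h
    refine h.congr' ?_
    filter_upwards [eventually_ne_atTop 0] with n hn
    have h0 : (n : ℂ) ≠ 0 := Nat.cast_ne_zero.mpr hn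
    rw [inv_Gamma_eq (x + n), gammaModel, gammaModel, Complex.cpow_add _ _ h0, Complex.cpow_one,
      inv_div, add_right_comm]
    field_simp

/-- The general term of `₃F₂(a, 1 - a, β; c, d; 1) / (Γ(c) Γ(d))`, meaningful for all `c`, `d`. -/
noncomputable def whippleTerm (a β c d : ℂ) (k : ℕ) : ℂ :=
  poch a k * poch (1 - a) k * poch β k / k.factorial *
    ((Complex.Gamma (c + k))⁻¹ * (Complex.Gamma (d + k))⁻¹)

theorem whippleTerm_swap (a β c d : ℂ) : whippleTerm a β c d = whippleTerm a β d c := by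
  funext k
  simp only [whippleTerm, mul_comm]

theorem tendsto_whippleTerm_mul_cpow (a β c d : ℂ) :
    Tendsto (fun k : ℕ => whippleTerm a β c d k * (k : ℂ) ^ (c + d - β)) atTop
      (𝓝 ((Complex.Gamma a)⁻¹ * (Complex.Gamma (1 - a))⁻¹ * (Complex.Gamma β)⁻¹)) := by
  have h := ((((tendsto_poch_div_gammaModel a).mul (tendsto_poch_div_gammaModel (1 - a))).mul
    (tendsto_poch_div_gammaModel β)).mul (tendsto_gammaModel_mul_inv_Gamma c)).mul
    (tendsto_gammaModel_mul_inv_Gamma d)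
  rw [mul_one, mul_one] at h
  refine h.congr' ?_
  filter_upwards [eventually_ne_atTop 0] with k hk
  have h0 : (k : ℂ) ≠ 0 := Nat.cast_ne_zero.mpr hk
  have h1 : ((k.factorial : ℕ) : ℂ) ≠ 0 := Nat.cast_ne_zero.mpr k.factorial_ne_zero
  have h2 (x : ℂ) : (k : ℂ) ^ x ≠ 0 := by simp [h0]
  have h3 := h2 a
  have h4 := h2 β
  simp only [gammaModel, whippleTerm]
  rw [Complex.cpow_sub (c + d) _ h0, Complex.cpow_add _ _ h0, Complex.cpow_sub _ _ h0,
    Complex.cpow_one]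
  field_simp

theorem whippleTerm_isBigO (a β c d : ℂ) :
    whippleTerm a β c d =O[atTop] fun k : ℕ => (k : ℝ) ^ (-(c + d - β).re) := by
  have h := ((tendsto_whippleTerm_mul_cpow a β c d).isBigO_one ℝ).mul
    (Asymptotics.isBigO_of_le (g := fun k : ℕ => (k : ℝ) ^ (-(c + d - β).re)) atTop
      (f := fun k : ℕ => if k = 0 then 0 else (k : ℂ) ^ (-(c + d - β))) fun k => by
        split_ifs with hk
        · simp
        · rw [Complex.norm_natCast_cpow_of_pos (Nat.pos_of_ne_zero hk), Complex.neg_re]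
          exact le_abs_self _)
  refine h.congr' ?_ (by simp)
  filter_upwards [eventually_ne_atTop 0] with k hk
  have h0 : (k : ℂ) ≠ 0 := Nat.cast_ne_zero.mpr hk
  rw [if_neg hk, mul_assoc, ← Complex.cpow_add _ _ h0, add_neg_cancel, Complex.cpow_zero, mul_one]

theorem natCast_mul_whippleTerm_isBigO (a β c d : ℂ) :
    (fun k : ℕ => (k : ℂ) * whippleTerm a β c d k) =O[atTop]
      fun k : ℕ => (k : ℝ) ^ (1 - (c + d - β).re) := by
  have h := (Asymptotics.isBigO_of_le (f := fun k : ℕ => (k : ℂ)) (g := fun k : ℕ => (k : ℝ)) atTop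
    fun k => by simp).mul (whippleTerm_isBigO a β c d)
  refine h.congr' (by simp) ?_
  filter_upwards [eventually_ne_atTop 0] with k hk
  rw [sub_eq_add_neg 1, Real.rpow_add (by positivity), Real.rpow_one]

theorem summable_whippleTerm {a β c d : ℂ} (h : 1 < (c + d - β).re) :
    Summable (whippleTerm a β c d) :=
  summable_of_isBigO_nat (Real.summable_nat_rpow.mpr (by linarith)) (whippleTerm_isBigO a β c d)

theorem summable_natCast_mul_whippleTerm {a β c d : ℂ} (h : 2 < (c + d - β).re) :
    Summable fun k : ℕ => (k : ℂ) * whippleTerm a β c d k :=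
  summable_of_isBigO_nat (Real.summable_nat_rpow.mpr (by linarith))
    (natCast_mul_whippleTerm_isBigO a β c d)

theorem tendsto_natCast_mul_whippleTerm {a β c d : ℂ} (h : 1 < (c + d - β).re) :
    Tendsto (fun k : ℕ => (k : ℂ) * whippleTerm a β c d k) atTop (𝓝 0) := by
  refine (natCast_mul_whippleTerm_isBigO a β c d).trans_tendsto ?_
  have := (tendsto_rpow_neg_atTop (y := (c + d - β).re - 1) (by linarith)).comp
    (tendsto_natCast_atTop_atTop (R := ℝ))
  simpa [Function.comp_def] using this

theorem whippleTerm_eq_mul (a β c d : ℂ) (k : ℕ) :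
    whippleTerm a β c d k = (c + k) * whippleTerm a β (c + 1) d k := by
  rw [whippleTerm, whippleTerm, inv_Gamma_eq (c + k), add_right_comm c k 1]
  ring

theorem whippleTerm_eq_mul' (a β c d : ℂ) (k : ℕ) :
    whippleTerm a β c d k = (d + k) * whippleTerm a β c (d + 1) k := by
  rw [whippleTerm_swap, whippleTerm_eq_mul, whippleTerm_swap]

theorem mul_whippleTerm_add_one (a β c d : ℂ) (k : ℕ) :
    β * whippleTerm a (β + 1) c d k = (β + k) * whippleTerm a β c d k := by
  rw [whippleTerm, whippleTerm]
  linear_combination poch a k * poch (1 - a) k / k.factorial *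
    ((Complex.Gamma (c + k))⁻¹ * (Complex.Gamma (d + k))⁻¹) * mul_poch_add_one β k

theorem mul_whippleTerm_succ (a β c d : ℂ) (k : ℕ) :
    ((k + 1 : ℕ) : ℂ) * whippleTerm a β c d (k + 1) =
      (a + k) * (1 - a + k) * (β + k) * whippleTerm a β (c + 1) (d + 1) k := by
  have h0 : ((k : ℂ) + 1) ≠ 0 := by exact_mod_cast k.succ_ne_zero
  have h1 : ((k.factorial : ℕ) : ℂ) ≠ 0 := Nat.cast_ne_zero.mpr k.factorial_ne_zero
  simp only [whippleTerm, poch_succ, Nat.factorial_succ]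
  push_cast
  rw [show c + ((k : ℂ) + 1) = c + 1 + k by ring, show d + ((k : ℂ) + 1) = d + 1 + k by ring]
  field_simp

theorem tsum_sub_succ_eq_zero {f g : ℕ → ℂ} (hf : Summable f) (h0 : g 0 = 0)
    (hg : Tendsto g atTop (𝓝 0)) (hfg : ∀ k, f k = g (k + 1) - g k) : ∑' k, f k = 0 := by
  refine tendsto_nhds_unique hf.hasSum.tendsto_sum_nat (hg.congr fun n => ?_)
  rw [Finset.sum_congr rfl fun k _ => hfg k, Finset.sum_range_sub, h0, sub_zero]

/-- The sum `₃F₂(a, 1 - a, (c + d - 1) / 2; c, d; 1) / (Γ(c) Γ(d))`. -/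
noncomputable def whippleSum (a c d : ℂ) : ℂ := ∑' k, whippleTerm a ((c + d - 1) / 2) c d k

theorem whippleSum_swap (a c d : ℂ) : whippleSum a c d = whippleSum a d c := by
  rw [whippleSum, whippleSum, whippleTerm_swap, add_comm c d]

theorem half_re (z : ℂ) : (z / 2).re = z.re / 2 := by
  simp

theorem whippleSum_add_two_right {a c d : ℂ} (h : 1 < (c + d).re) :
    whippleSum a c d = (d + a) * (d + 1 - a) * whippleSum a c (d + 2) := by
  obtain ⟨b, hb⟩ : ∃ b, b = (c + d - 1) / 2 := ⟨_, rfl⟩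
  have hc : c = 2 * b + 1 - d := by rw [hb]; ring
  have hre : 0 < b.re := by
    rw [hb, half_re]; simp at h ⊢; linarith
  have hb0 : b ≠ 0 := by rintro rfl; simp at hre
  have hb' : (c + (d + 2) - 1) / 2 = b + 1 := by rw [hb]; ring
  have hs1 : Summable (whippleTerm a b c d) := summable_whippleTerm (by rw [hc]; simp; linarith)
  have hs2 : Summable (whippleTerm a (b + 1) c (d + 2)) :=
    summable_whippleTerm (by rw [hc]; simp; linarith)
  have hs3 : 1 < ((c - 1) + (d + 1) - b).re := by rw [hc]; simp; linarith
  have key := tsum_sub_succ_eq_zero (hs1.sub (hs2.mul_left ((d + a) * (d + 1 - a))))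
    (g := fun k : ℕ => -b⁻¹ * ((k : ℂ) * whippleTerm a b (c - 1) (d + 1) k)) (by simp)
    (by simpa using (tendsto_natCast_mul_whippleTerm (a := a) hs3).const_mul (-b⁻¹)) ?_
  · rw [(hs1.hasSum.sub (hs2.mul_left _).hasSum).tsum_eq, tsum_mul_left, sub_eq_zero] at key
    rw [whippleSum, whippleSum, hb', ← hb, key]
  · intro k
    have e1 := mul_whippleTerm_succ a b (c - 1) (d + 1) k
    have e2 := whippleTerm_eq_mul a b (c - 1) (d + 1) k
    have e3 := whippleTerm_eq_mul' a b c (d + 1) k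
    have e4 := whippleTerm_eq_mul' a b c d k
    have e5 := mul_whippleTerm_add_one a b c (d + 2) k
    rw [show d + 1 + 1 = d + 2 by ring] at e1 e3
    rw [sub_add_cancel] at e1 e2
    rw [e3] at e2 e4
    simp only [e1, e2, e4]
    have e6 : whippleTerm a (b + 1) c (d + 2) k = (b + k) * whippleTerm a b c (d + 2) k / b := by
      rw [← e5]; field_simp
    rw [e6, hc]
    field_simp
    ring

theorem norm_half_div_mul_le_inv {z w : ℂ} {y : ℝ} (hy : 0 < y) (hz : y + 1 ≤ ‖z‖)
    (hw : y + 1 ≤ ‖w‖) : ‖(z + w - 1) / 2 / (z * w)‖ ≤ y⁻¹ := by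
  have h : ‖(z + w - 1) / 2‖ ≤ (‖z‖ + ‖w‖ + 1) / 2 := by
    rw [norm_div, Complex.norm_ofNat]
    have := norm_sub_le (z + w) 1
    have := norm_add_le z w
    rw [norm_one] at *
    linarith
  rw [norm_div, norm_mul, inv_eq_one_div]
  rw [div_le_div_iff₀ (mul_pos (by linarith) (by linarith)) hy]
  nlinarith [mul_nonneg (sub_nonneg.mpr hz) (sub_nonneg.mpr hw),
    mul_le_mul_of_nonneg_right h hy.le]

theorem add_one_le_norm_add_natCast {c : ℂ} {N n j : ℕ} (hN : 1 - c.re ≤ N) (hn : N ≤ n) :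
    ((n - N : ℕ) + j : ℝ) + 1 ≤ ‖c + n + j‖ := by
  refine le_trans ?_ (Complex.re_le_norm _)
  rw [Nat.cast_sub hn]
  simp
  linarith

theorem tendsto_Gamma_mul_whippleSum (a c d : ℂ) :
    Tendsto (fun n : ℕ => Complex.Gamma (c + n) * Complex.Gamma (d + n) *
      whippleSum a (c + n) (d + n)) atTop (𝓝 1) := by
  obtain ⟨N, hN⟩ := exists_nat_ge (max (1 - c.re) (1 - d.re))
  have hNc := (le_max_left _ _).trans hN
  have hNd := (le_max_right _ _).trans hN
  let r : ℕ → ℕ → ℂ := fun n j =>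
    ((c + n + j) + (d + n + j) - 1) / 2 / ((c + n + j) * (d + n + j))
  have hr : ∀ {n j : ℕ}, N + 2 ≤ n → ‖r n j‖ ≤ ((n - N : ℕ) + j : ℝ)⁻¹ := fun {n j} hn =>
    norm_half_div_mul_le_inv
      (add_pos_of_pos_of_nonneg (by exact_mod_cast (by omega : 0 < n - N)) j.cast_nonneg)
      (add_one_le_norm_add_natCast hNc (by omega)) (add_one_le_norm_add_natCast hNd (by omega))
  let f : ℕ → ℕ → ℂ := fun n k =>
    poch a k * poch (1 - a) k / k.factorial * ∏ j ∈ Finset.range k, r n j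
  have hf : ∀ᶠ n : ℕ in atTop, ∑' k, f n k = Complex.Gamma (c + n) * Complex.Gamma (d + n) *
      whippleSum a (c + n) (d + n) := by
    filter_upwards [eventually_ge_atTop (N + 2)] with n hn
    have hpole : ∀ x : ℂ, 1 - x.re ≤ N → ∀ m : ℕ, x + n ≠ -m := by
      intro x hx
      have h2 : ((N + 2 : ℕ) : ℝ) ≤ n := by exact_mod_cast hn
      push_cast at h2
      exact ne_neg_natCast_of_re_pos (by simp; linarith)
    rw [whippleSum, ← tsum_mul_left]
    refine tsum_congr fun k => ?_
    have hΓc := Complex.Gamma_ne_zero (hpole c hNc)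
    have hΓd := Complex.Gamma_ne_zero (hpole d hNd)
    have hprod : ∏ j ∈ Finset.range k, r n j = poch ((c + n + (d + n) - 1) / 2) k /
        (poch (c + n) k * poch (d + n) k) := by
      simp only [r, poch, Finset.prod_div_distrib, Finset.prod_mul_distrib]
      rw [← Finset.prod_div_distrib]
      congr 1
      exact Finset.prod_congr rfl fun j _ => by ring
    simp only [f]
    rw [hprod, whippleTerm, Gamma_add_natCast (hpole c hNc), Gamma_add_natCast (hpole d hNd)]
    field_simp
  refine Tendsto.congr' hf ?_
  have hlim : ∀ k, Tendsto (fun n => f n k) atTop (𝓝 (if k = 0 then 1 else 0)) := by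
    intro k
    have hr0 : ∀ j, Tendsto (fun n => r n j) atTop (𝓝 0) := by
      intro j
      refine squeeze_zero_norm' (a := fun n : ℕ => ((n - N : ℕ) + j : ℝ)⁻¹)
        ((eventually_ge_atTop (N + 2)).mono fun n hn => hr hn) ?_
      exact ((tendsto_natCast_atTop_atTop.comp (tendsto_sub_atTop_nat N)).atTop_add
        tendsto_const_nhds).inv_tendsto_atTop
    have := (tendsto_finsetProd (Finset.range k) fun j _ => hr0 j).const_mul
      (poch a k * poch (1 - a) k / k.factorial)
    refine this.trans_eq ?_
    rcases eq_or_ne k 0 with rfl | hk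
    · simp [poch]
    · simp [hk]
  have hbound : Summable fun k => ‖whippleTerm a 1 2 1 k‖ :=
    (summable_whippleTerm (by norm_num)).norm
  have := tendsto_tsum_of_dominated_convergence hbound hlim
    ((eventually_ge_atTop (N + 2)).mono fun n hn k => ?_)
  · simpa using this
  · have h1 : whippleTerm a 1 2 1 k = poch a k * poch (1 - a) k / k.factorial * (poch 2 k)⁻¹ := by
      have hp1 : ∀ m : ℕ, (1 : ℂ) ≠ -m := ne_neg_natCast_of_re_pos (by simp)
      have hp2 : ∀ m : ℕ, (2 : ℂ) ≠ -m := ne_neg_natCast_of_re_pos (by simp)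
      have h1 : poch 1 k ≠ 0 := by
        refine Finset.prod_ne_zero_iff.mpr fun j _ h => ?_
        exact hp1 j (eq_neg_of_add_eq_zero_left h)
      rw [whippleTerm, Gamma_add_natCast hp1, Gamma_add_natCast hp2, Complex.Gamma_one,
        show Complex.Gamma 2 = 1 by simp]
      field_simp
    rw [h1, norm_mul, norm_mul]
    gcongr
    rw [norm_prod, norm_inv, poch, norm_prod, ← Finset.prod_inv_distrib]
    refine Finset.prod_le_prod (fun _ _ => norm_nonneg _) fun j _ => (hr hn).trans ?_
    have h2 : ‖(2 : ℂ) + j‖ = 2 + j := by exact_mod_cast Complex.norm_natCast (2 + j)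
    rw [h2]
    have h3 : (2 : ℝ) ≤ (n - N : ℕ) := by exact_mod_cast (by omega : 2 ≤ n - N)
    gcongr

/-- The closed form of `whippleSum a c d`. -/
noncomputable def whippleValue (a c d : ℂ) : ℂ :=
  Real.pi * 2 ^ (2 - c - d) *
    ((Complex.Gamma ((c + a) / 2))⁻¹ * (Complex.Gamma ((c + 1 - a) / 2))⁻¹ *
      ((Complex.Gamma ((d + a) / 2))⁻¹ * (Complex.Gamma ((d + 1 - a) / 2))⁻¹))

theorem whippleValue_swap (a c d : ℂ) : whippleValue a c d = whippleValue a d c := by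
  rw [whippleValue, whippleValue, sub_right_comm 2 c d]
  ring

theorem whippleValue_add_two_right (a c d : ℂ) :
    whippleValue a c d = (d + a) * (d + 1 - a) * whippleValue a c (d + 2) := by
  rw [whippleValue, whippleValue, inv_Gamma_eq ((d + a) / 2), inv_Gamma_eq ((d + 1 - a) / 2),
    show (d + a) / 2 + 1 = (d + 2 + a) / 2 by ring,
    show (d + 1 - a) / 2 + 1 = (d + 2 + 1 - a) / 2 by ring,
    show 2 - c - d = 2 - c - (d + 2) + (2 : ℕ) by push_cast; ring,
    Complex.cpow_add _ _ two_ne_zero, Complex.cpow_natCast]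
  ring

theorem Gamma_half_mul_Gamma_half (s : ℂ) :
    Complex.Gamma (s / 2) * Complex.Gamma ((s + 1) / 2) =
      Complex.Gamma s * 2 ^ (1 - s) * (√Real.pi : ℝ) := by
  have := Complex.Gamma_mul_Gamma_add_half (s / 2)
  rwa [mul_div_cancel₀ s two_ne_zero, ← add_div] at this

theorem Gamma_half_quadruple (c d : ℂ) :
    Complex.Gamma (c / 2) * Complex.Gamma ((c + 1) / 2) *
      (Complex.Gamma (d / 2) * Complex.Gamma ((d + 1) / 2)) =
      Complex.Gamma c * Complex.Gamma d * (Real.pi * 2 ^ (2 - c - d)) := by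
  have hpi : ((√Real.pi : ℝ) : ℂ) * (√Real.pi : ℝ) = Real.pi := by
    rw [← Complex.ofReal_mul, Real.mul_self_sqrt Real.pi_pos.le]
  rw [Gamma_half_mul_Gamma_half, Gamma_half_mul_Gamma_half,
    show 2 - c - d = (1 - c) + (1 - d) by ring, Complex.cpow_add _ _ two_ne_zero, ← hpi]
  ring

theorem tendsto_Gamma_mul_whippleValue (a c d : ℂ) :
    Tendsto (fun n : ℕ => Complex.Gamma (c + (2 * n : ℕ)) * Complex.Gamma (d + (2 * n : ℕ)) *
      whippleValue a (c + (2 * n : ℕ)) (d + (2 * n : ℕ))) atTop (𝓝 1) := by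
  have hnum (s : ℂ) := (tendsto_gammaModel_mul_inv_Gamma s).inv₀ one_ne_zero
  have hden := tendsto_gammaModel_mul_inv_Gamma
  have h := ((((hnum (c / 2)).mul (hnum ((c + 1) / 2))).mul
    ((hnum (d / 2)).mul (hnum ((d + 1) / 2)))).mul
    (((hden ((c + a) / 2)).mul (hden ((c + 1 - a) / 2))).mul
    ((hden ((d + a) / 2)).mul (hden ((d + 1 - a) / 2)))))
  simp only [inv_one, mul_one] at h
  refine h.congr' ?_
  filter_upwards [eventually_ne_atTop 0] with n hn
  have h0 : (n : ℂ) ≠ 0 := Nat.cast_ne_zero.mpr hn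
  have hshift (x : ℂ) : (x + (2 * n : ℕ)) / 2 = x / 2 + n := by push_cast; ring
  have hmodel : gammaModel ((c + a) / 2) n * gammaModel ((c + 1 - a) / 2) n *
      (gammaModel ((d + a) / 2) n * gammaModel ((d + 1 - a) / 2) n) =
      gammaModel (c / 2) n * gammaModel ((c + 1) / 2) n *
      (gammaModel (d / 2) n * gammaModel ((d + 1) / 2) n) := by
    have hcp (x y : ℂ) : gammaModel x n * gammaModel y n =
        (n : ℂ) ^ (x + y) * (n.factorial / n) ^ 2 := by
      rw [gammaModel, gammaModel, Complex.cpow_add _ _ h0]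
      ring
    rw [hcp, hcp, hcp, hcp]
    ring_nf
  have hne := fun x => gammaModel_ne_zero x hn
  have hquad := Gamma_half_quadruple (c + (2 * n : ℕ)) (d + (2 * n : ℕ))
  rw [whippleValue, ← mul_assoc (Complex.Gamma _ * Complex.Gamma _), ← hquad]
  simp only [add_right_comm _ ((2 * n : ℕ) : ℂ), add_sub_right_comm _ ((2 * n : ℕ) : ℂ), hshift]
  have hne4 := mul_ne_zero (mul_ne_zero (hne (c / 2)) (hne ((c + 1) / 2)))
    (mul_ne_zero (hne (d / 2)) (hne ((d + 1) / 2)))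
  have hcancel := mul_inv_cancel₀ hne4
  simp only [mul_inv, inv_inv] at hcancel ⊢
  rw [← hmodel] at hcancel
  linear_combination (Complex.Gamma (c / 2 + n) * Complex.Gamma ((c + 1) / 2 + n) *
    (Complex.Gamma (d / 2 + n) * Complex.Gamma ((d + 1) / 2 + n)) *
    ((Complex.Gamma ((c + a) / 2 + n))⁻¹ * (Complex.Gamma ((c + 1 - a) / 2 + n))⁻¹ *
    ((Complex.Gamma ((d + a) / 2 + n))⁻¹ * (Complex.Gamma ((d + 1 - a) / 2 + n))⁻¹))) * hcancel

theorem whippleSum_mul_whippleValue_shift {a c d : ℂ} (h : 1 < (c + d).re) (n : ℕ) :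
    whippleSum a c d * whippleValue a (c + (2 * n : ℕ)) (d + (2 * n : ℕ)) =
      whippleValue a c d * whippleSum a (c + (2 * n : ℕ)) (d + (2 * n : ℕ)) := by
  suffices ∃ R : ℂ, whippleSum a c d = R * whippleSum a (c + (2 * n : ℕ)) (d + (2 * n : ℕ)) ∧
      whippleValue a c d = R * whippleValue a (c + (2 * n : ℕ)) (d + (2 * n : ℕ)) by
    obtain ⟨R, h1, h2⟩ := this
    rw [h1, h2]
    ring
  induction n with
  | zero => exact ⟨1, by simp, by simp⟩
  | succ n ih =>
    obtain ⟨R, h1, h2⟩ := ih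
    obtain ⟨x, hx⟩ : ∃ x, x = c + (2 * n : ℕ) := ⟨_, rfl⟩
    obtain ⟨y, hy⟩ : ∃ y, y = d + (2 * n : ℕ) := ⟨_, rfl⟩
    have hxy : 1 < (x + y).re := by
      rw [hx, hy]
      simp at h ⊢
      linarith [(Nat.cast_nonneg n : (0 : ℝ) ≤ n)]
    have hxy' : 1 < (y + 2 + x).re := by
      simp at hxy ⊢
      linarith
    rw [show c + (2 * (n + 1) : ℕ) = x + 2 by rw [hx]; push_cast; ring,
      show d + (2 * (n + 1) : ℕ) = y + 2 by rw [hy]; push_cast; ring]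
    rw [← hx, ← hy] at h1 h2
    refine ⟨R * ((y + a) * (y + 1 - a)) * ((x + a) * (x + 1 - a)), ?_, ?_⟩
    · rw [h1, whippleSum_add_two_right hxy, whippleSum_swap, whippleSum_add_two_right hxy',
        whippleSum_swap]
      ring
    · rw [h2, whippleValue_add_two_right, whippleValue_swap, whippleValue_add_two_right,
        whippleValue_swap]
      ring

/-- **Whipple's theorem**, in a form regular at all parameters `c`, `d`. -/
theorem whippleSum_eq_whippleValue {a c d : ℂ} (h : 1 < (c + d).re) :
    whippleSum a c d = whippleValue a c d := by
  have h1 := (tendsto_Gamma_mul_whippleValue a c d).const_mul (whippleSum a c d)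
  have h2 := ((tendsto_Gamma_mul_whippleSum a c d).comp
    (tendsto_id.const_mul_atTop' (two_pos : 0 < 2))).const_mul (whippleValue a c d)
  rw [mul_one] at h1 h2
  refine tendsto_nhds_unique h1 (h2.congr fun n => ?_)
  have := whippleSum_mul_whippleValue_shift (a := a) h n
  simp only [Function.comp_apply, id]
  linear_combination -(Complex.Gamma (c + (2 * n : ℕ)) * Complex.Gamma (d + (2 * n : ℕ))) * this

/-- Contiguous relation reducing the sum weighted by `k` to two sums of Whipple type. -/
theorem tsum_natCast_mul_whippleTerm {a b c e : ℂ} (hb : 1 < b.re) (hce : c + e = 2 * b) :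
    (1 - b) * b * ∑' k : ℕ, (k : ℂ) * whippleTerm a (b + 1) (c + 1) (e + 1) k =
      (a ^ 2 - a + b * c - c ^ 2) / 2 * whippleSum a (c + 1) e +
      (a ^ 2 - a - 2 * b ^ 2 + 3 * b * c - c ^ 2) / 2 * whippleSum a c (e + 1) := by
  obtain rfl : e = 2 * b - c := by rw [← hce]; ring
  have hs1 : Summable fun k : ℕ => (k : ℂ) * whippleTerm a (b + 1) (c + 1) (2 * b - c + 1) k :=
    summable_natCast_mul_whippleTerm (by simp; linarith)
  have hs2 : Summable (whippleTerm a b (c + 1) (2 * b - c)) :=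
    summable_whippleTerm (by simp; linarith)
  have hs3 : Summable (whippleTerm a b c (2 * b - c + 1)) :=
    summable_whippleTerm (by simp; linarith)
  have hs4 : 1 < (c + (2 * b - c) - b).re := by simp; linarith
  have h1 := (hs1.mul_left ((1 - b) * b)).sub
    ((hs2.mul_left ((a ^ 2 - a + b * c - c ^ 2) / 2)).add
    (hs3.mul_left ((a ^ 2 - a - 2 * b ^ 2 + 3 * b * c - c ^ 2) / 2)))
  have key := tsum_sub_succ_eq_zero h1
    (g := fun k : ℕ => (k : ℂ) * whippleTerm a b c (2 * b - c) k) (by simp)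
    (tendsto_natCast_mul_whippleTerm hs4) ?_
  · rw [((hs1.mul_left _).hasSum.sub ((hs2.mul_left _).hasSum.add (hs3.mul_left _).hasSum)).tsum_eq,
      tsum_mul_left, tsum_mul_left, tsum_mul_left, sub_eq_zero] at key
    rw [key, whippleSum, whippleSum, show (c + 1 + (2 * b - c) - 1) / 2 = b by ring,
      show (c + (2 * b - c + 1) - 1) / 2 = b by ring]
  · intro k
    have e1 := mul_whippleTerm_succ a b c (2 * b - c) k
    have e2 := whippleTerm_eq_mul a b c (2 * b - c) k
    have e3 := whippleTerm_eq_mul' a b (c + 1) (2 * b - c) k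
    have e4 := whippleTerm_eq_mul a b c (2 * b - c + 1) k
    have e5 := mul_whippleTerm_add_one a b (c + 1) (2 * b - c + 1) k
    simp only [e1, e2, e3, e4]
    linear_combination (1 - b) * k * e5

theorem stmt8 (a b c : ℂ) (hb : 1 < b.re)
    (hc : ∀ m : ℤ, m < 0 → c ≠ (m : ℂ) ∧ 2 * b - c ≠ (m : ℂ))
    (hΓ : ∀ m : ℤ, m ≤ 0 →
      (1 + c) / 2 ≠ (m : ℂ) ∧ (2 + c) / 2 ≠ (m : ℂ) ∧
      b + (1 - c) / 2 ≠ (m : ℂ) ∧ b + (2 - c) / 2 ≠ (m : ℂ)) :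
    ∑' k : ℕ, (k : ℂ) * poch a k * poch (1 - a) k * poch (1 + b) k /
        ((k.factorial : ℂ) * poch (1 + c) k * poch (1 + 2 * b - c) k)
    = ((a ^ 2 - a + b * c - c ^ 2) / (b * (1 - b))) *
        (Complex.Gamma ((1 + c) / 2) * Complex.Gamma ((2 + c) / 2) *
            Complex.Gamma (b + (1 - c) / 2) * Complex.Gamma (b + (2 - c) / 2)) /
        (Complex.Gamma ((1 + a + c) / 2) * Complex.Gamma ((2 - a + c) / 2) *
            Complex.Gamma (b + (a - c) / 2) * Complex.Gamma (b + (1 - a - c) / 2))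
      + ((a ^ 2 - a - 2 * b ^ 2 + 3 * b * c - c ^ 2) / (b * (1 - b))) *
        (Complex.Gamma ((1 + c) / 2) * Complex.Gamma ((2 + c) / 2) *
            Complex.Gamma (b + (1 - c) / 2) * Complex.Gamma (b + (2 - c) / 2)) /
        (Complex.Gamma ((a + c) / 2) * Complex.Gamma ((1 - a + c) / 2) *
            Complex.Gamma (b + (1 + a - c) / 2) * Complex.Gamma (b + (2 - a - c) / 2)) := by
  have hpc : ∀ m : ℕ, c + 1 ≠ -m := by
    intro m h
    refine (hc (-(m + 1)) (by omega)).1 ?_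
    push_cast
    linear_combination h
  have hpe : ∀ m : ℕ, 2 * b - c + 1 ≠ -m := by
    intro m h
    refine (hc (-(m + 1)) (by omega)).2 ?_
    push_cast
    linear_combination h
  have hΓc := Complex.Gamma_ne_zero hpc
  have hΓe := Complex.Gamma_ne_zero hpe
  have hb0 : b ≠ 0 := by rintro rfl; norm_num at hb
  have hb1 : 1 - b ≠ 0 := by
    intro h
    rw [← sub_eq_zero.mp h] at hb
    norm_num at hb
  have hterm : ∀ k : ℕ, (k : ℂ) * poch a k * poch (1 - a) k * poch (1 + b) k /
      ((k.factorial : ℂ) * poch (1 + c) k * poch (1 + 2 * b - c) k) =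
      Complex.Gamma (c + 1) * Complex.Gamma (2 * b - c + 1) *
        ((k : ℂ) * whippleTerm a (b + 1) (c + 1) (2 * b - c + 1) k) := by
    intro k
    rw [whippleTerm, Gamma_add_natCast hpc, Gamma_add_natCast hpe, add_comm 1 b, add_comm 1 c,
      show 1 + 2 * b - c = 2 * b - c + 1 by ring]
    generalize 2 * b - c + 1 = x at hΓe ⊢
    field_simp
  have hsum := tsum_natCast_mul_whippleTerm (a := a) (b := b) (c := c) (e := 2 * b - c) hb (by ring)
  rw [whippleSum_eq_whippleValue (by simp; linarith),
    whippleSum_eq_whippleValue (by simp; linarith), whippleValue, whippleValue] at hsum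
  have hquad := Gamma_half_quadruple (c + 1) (2 * b - c + 1)
  have hpow : (2 : ℂ) ^ (2 - (c + 1) - (2 * b - c)) = 2 * 2 ^ (2 - (c + 1) - (2 * b - c + 1)) := by
    rw [show 2 - (c + 1) - (2 * b - c) = 1 + (2 - (c + 1) - (2 * b - c + 1)) by ring,
      Complex.cpow_add _ _ two_ne_zero, Complex.cpow_one]
  rw [show 2 - c - (2 * b - c + 1) = 2 - (c + 1) - (2 * b - c) by ring, hpow] at hsum
  rw [tsum_congr hterm, tsum_mul_left]
  rw [show (1 + c) / 2 = (c + 1) / 2 by ring, show (2 + c) / 2 = (c + 1 + 1) / 2 by ring,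
    show b + (1 - c) / 2 = (2 * b - c + 1) / 2 by ring,
    show b + (2 - c) / 2 = (2 * b - c + 1 + 1) / 2 by ring, mul_assoc (_ * _) (Complex.Gamma _),
    hquad,
    show (1 + a + c) / 2 = (c + 1 + a) / 2 by ring,
    show (2 - a + c) / 2 = (c + 1 + 1 - a) / 2 by ring,
    show b + (a - c) / 2 = (2 * b - c + a) / 2 by ring,
    show b + (1 - a - c) / 2 = (2 * b - c + 1 - a) / 2 by ring,
    show (a + c) / 2 = (c + a) / 2 by ring,
    show (1 - a + c) / 2 = (c + 1 - a) / 2 by ring,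
    show b + (1 + a - c) / 2 = (2 * b - c + 1 + a) / 2 by ring,
    show b + (2 - a - c) / 2 = (2 * b - c + 1 + 1 - a) / 2 by ring]
  refine mul_left_cancel₀ (mul_ne_zero hb1 hb0) ?_
  rw [mul_left_comm, hsum]
  simp only [div_eq_mul_inv, mul_inv]
  field_simp
end

section
/- For every positive integer n, Σ_{k=0}^{n} (−1)^k C(n,k) H_{n+k}^{⟨2⟩} = (1/(n · C(2n,n))) · (H_n − H_{2n}). -/
open Finset

/-- Harmonic number `H_n = ∑_{k=1}^n 1/k`. -/
noncomputable def harm (n : ℕ) : ℝ := ∑ k ∈ Finset.range n, 1 / ((k : ℝ) + 1)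

/-- Second-order harmonic number `H_n^{⟨2⟩} = ∑_{k=1}^n 1/k²`. -/
noncomputable def harm2 (n : ℕ) : ℝ := ∑ k ∈ Finset.range n, 1 / ((k : ℝ) + 1) ^ 2

lemma harm_succ (n : ℕ) : harm (n + 1) = harm n + 1 / ((n : ℝ) + 1) :=
  Finset.sum_range_succ _ _

lemma harm2_succ (n : ℕ) : harm2 (n + 1) = harm2 n + 1 / ((n : ℝ) + 1) ^ 2 :=
  Finset.sum_range_succ _ _

/-- Pascal's rule for alternating binomial sums. -/
lemma alternating_choose_sum_succ (f : ℕ → ℝ) (n : ℕ) :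
    ∑ k ∈ Finset.range (n + 2), (-1 : ℝ) ^ k * ((n + 1).choose k : ℝ) * f k
      = ∑ k ∈ Finset.range (n + 1), (-1 : ℝ) ^ k * (n.choose k : ℝ) * f k
        - ∑ k ∈ Finset.range (n + 1), (-1 : ℝ) ^ k * (n.choose k : ℝ) * f (k + 1) := by
  have h := Finset.sum_choose_succ_mul (fun i _ => (-1 : ℝ) ^ i * f i) n
  rw [sub_eq_add_neg, ← Finset.sum_neg_distrib]
  convert h using 1
  · exact Finset.sum_congr rfl fun k _ => by ring
  · congr 1 <;> exact Finset.sum_congr rfl fun k _ => by ring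

/-- Alternating binomial sums of shifted second-order harmonic numbers. -/
lemma alternating_choose_sum_harm2 (n m : ℕ) :
    ∑ k ∈ Finset.range (n + 2), (-1 : ℝ) ^ k * ((n + 1).choose k : ℝ) * harm2 (m + k)
      = (n.factorial : ℝ) * m.factorial / (m + n + 1).factorial
        * (harm m - harm (m + n + 1)) := by
  induction n generalizing m with
  | zero =>
    have hm : (m : ℝ) + 1 ≠ 0 := by positivity
    have hf : (m.factorial : ℝ) ≠ 0 := by positivity
    simp [Finset.sum_range_succ, harm_succ, harm2_succ, Nat.factorial_succ]
    field_simp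
  | succ n ih =>
    have h := ih (m + 1)
    simp only [add_right_comm m 1, add_assoc m _ 1] at h
    rw [alternating_choose_sum_succ, ih m]
    simp only [← add_assoc] at h ⊢
    rw [h]
    have h₁ : (m : ℝ) + 1 ≠ 0 := by positivity
    have h₂ : (m : ℝ) + n + 1 + 1 ≠ 0 := by positivity
    have h₃ : ((m + n + 1).factorial : ℝ) ≠ 0 := by positivity
    rw [harm_succ (m + n + 1), harm_succ m, Nat.factorial_succ (m + n + 1),
      Nat.factorial_succ m, Nat.factorial_succ n]
    push_cast
    field_simp
    ring

theorem stmt12 (n : ℕ) (hn : 0 < n) :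
    ∑ k ∈ Finset.range (n + 1), (-1 : ℝ) ^ k * (n.choose k : ℝ) * harm2 (n + k)
    = (1 / ((n : ℝ) * ((2 * n).choose n : ℝ))) * (harm n - harm (2 * n)) := by
  obtain ⟨m, rfl⟩ := Nat.exists_eq_succ_of_ne_zero hn.ne'
  have h := alternating_choose_sum_harm2 m (m + 1)
  have hd : m + 1 + m + 1 = 2 * (m + 1) := by ring
  rw [hd] at h
  rw [Nat.succ_eq_add_one, h]
  congr 1
  have hc := Nat.choose_mul_factorial_mul_factorial (show m + 1 ≤ 2 * (m + 1) by omega)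
  rw [show 2 * (m + 1) - (m + 1) = m + 1 by omega] at hc
  have hp : ((2 * (m + 1)).choose (m + 1) : ℝ) ≠ 0 :=
    Nat.cast_ne_zero.mpr (Nat.choose_pos (by omega)).ne'
  have hf : (m.factorial : ℝ) ≠ 0 := by positivity
  rw [← hc, Nat.factorial_succ]
  push_cast
  field_simp
end
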